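/- Let (M_n) be a mean-zero martingale, fix z > 0, and let T_z = inf{n ≥ 1 : M_n > 0 or M_n < −z} (T_z = ∞ if no such n exists). Suppose P(T_z < ∞) = 1 and that there exists B < ∞ such that for every n ≥ 1 with P(T_z = n, M_n > 0) > 0 one has E[M_n · 1(T_z = n, M_n > 0)] ≤ B · P(T_z = n, M_n > 0). Then P(M_{T_z} > 0) ≥ z/(B + z). -/

import Mathlib

open MeasureTheory Filter Set Topology ENNReal

/-- The infimum of a set of naturals, taken in `ℕ∞`, exceeds `n` iff no member is at most `n`. -/
lemma ENat.coe_lt_sInf_image_iff (S : Set ℕ) (n : ℕ) :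
    (n : ℕ∞) < sInf ((fun k : ℕ => (k : ℕ∞)) '' S) ↔ ∀ k ∈ S, n < k := by
  refine ⟨fun h k hk => ?_, fun h => ?_⟩
  · exact_mod_cast h.trans_le (sInf_le (mem_image_of_mem _ hk))
  · rcases S.eq_empty_or_nonempty with rfl | hS
    · simp
    · obtain ⟨k, hk, hkS⟩ := csInf_mem (hS.image fun k : ℕ => (k : ℕ∞))
      rw [← hkS]
      exact Nat.cast_lt.mpr (h k hk)

/-- If the infimum of a set of naturals, taken in `ℕ∞`, is finite, then it belongs to the set. -/
lemma ENat.mem_of_sInf_image_eq_coe {S : Set ℕ} {n : ℕ}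
    (h : sInf ((fun k : ℕ => (k : ℕ∞)) '' S) = n) : n ∈ S := by
  rcases S.eq_empty_or_nonempty with rfl | hS
  · simp at h
  · obtain ⟨k, hk, hkS⟩ := csInf_mem (hS.image fun k : ℕ => (k : ℕ∞))
    have : (k : ℕ∞) = n := hkS.trans h
    rwa [← Nat.cast_inj.mp this]

/-- The measure of an event occurring at a finite value of a nonzero random time `T`, decomposed
along the values of `T`. -/
lemma hasSum_measureReal_eq_coe_succ {Ω : Type*} {m0 : MeasurableSpace Ω} {μ : Measure Ω}
    [IsFiniteMeasure μ] {T : Ω → ℕ∞} (hT : ∀ ω, T ω ≠ 0) {A : ℕ → Set Ω}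
    (hA : ∀ n : ℕ, MeasurableSet {ω | T ω = ((n + 1 : ℕ) : ℕ∞) ∧ ω ∈ A (n + 1)}) :
    HasSum (fun n : ℕ => μ.real {ω | T ω = ((n + 1 : ℕ) : ℕ∞) ∧ ω ∈ A (n + 1)})
      (μ.real {ω | T ω < ⊤ ∧ ω ∈ A (T ω).toNat}) := by
  have hunion : {ω | T ω < ⊤ ∧ ω ∈ A (T ω).toNat} =
      ⋃ n : ℕ, {ω | T ω = ((n + 1 : ℕ) : ℕ∞) ∧ ω ∈ A (n + 1)} := by
    ext ω
    simp only [mem_ofPred_eq, mem_iUnion]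
    constructor
    · rintro ⟨hlt, hω⟩
      obtain ⟨n, hn⟩ := ENat.ne_top_iff_exists.mp hlt.ne
      rw [← hn, ENat.toNat_natCast] at hω
      cases n with
      | zero => exact absurd hn.symm (hT ω)
      | succ n => exact ⟨n, hn.symm, hω⟩
    · rintro ⟨n, hn, hω⟩
      rw [hn, ENat.toNat_natCast]
      exact ⟨ENat.natCast_lt_top _, hω⟩
  have hdisj : Pairwise (Function.onFun Disjoint
      fun n : ℕ => {ω | T ω = ((n + 1 : ℕ) : ℕ∞) ∧ ω ∈ A (n + 1)}) := by
    intro i j hij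
    refine Set.disjoint_left.mpr fun ω hi hj => hij ?_
    have := hi.1.symm.trans hj.1
    have := Nat.cast_inj.mp this
    omega
  have hmeas := measure_iUnion (μ := μ) hdisj hA
  have hfinite : ∑' n : ℕ, μ {ω | T ω = ((n + 1 : ℕ) : ℕ∞) ∧ ω ∈ A (n + 1)} ≠ ∞ :=
    hmeas ▸ measure_ne_top μ _
  rw [measureReal_def, hunion, hmeas, ENNReal.tsum_toReal_eq fun n => measure_ne_top μ _]
  exact ENNReal.hasSum_toReal hfinite

/-- Let `(M n)` be a mean-zero martingale, `z > 0`, and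
`T_z = inf{n ≥ 1 : M_n > 0 or M_n < −z}`.  If `P(T_z < ∞) = 1` and there is `B < ∞` with
`E[M_n · 1(T_z = n, M_n > 0)] ≤ B · P(T_z = n, M_n > 0)` whenever the latter probability
is positive, then `P(M_{T_z} > 0) ≥ z/(B + z)`. -/
theorem exit_time_upcrossing_probability_bound
    {Ω : Type*} {m0 : MeasurableSpace Ω} {μ : Measure Ω} [IsProbabilityMeasure μ]
    (𝓕 : Filtration ℕ m0) (M : ℕ → Ω → ℝ)
    (hM : Martingale M 𝓕 μ)
    (hmean : ∀ n, ∫ ω, M n ω ∂μ = 0)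
    (z : ℝ) (hz : 0 < z)
    (Tz : Ω → ℕ∞)
    (hTzdef : ∀ ω, Tz ω =
      sInf ((fun n : ℕ => (n : ℕ∞)) '' {n : ℕ | 1 ≤ n ∧ (0 < M n ω ∨ M n ω < -z)}))
    (hfin : μ {ω | Tz ω < ⊤} = 1)
    (B : ℝ)
    (hover : ∀ n : ℕ, 1 ≤ n → 0 < μ {ω | Tz ω = (n : ℕ∞) ∧ 0 < M n ω} →
      ∫ ω in {ω | Tz ω = (n : ℕ∞) ∧ 0 < M n ω}, M n ω ∂μ ≤
        B * (μ {ω | Tz ω = (n : ℕ∞) ∧ 0 < M n ω}).toReal) :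
    ENNReal.ofReal (z / (B + z)) ≤ μ {ω | Tz ω < ⊤ ∧ 0 < M (Tz ω).toNat ω} := by
  have hlt (n : ℕ) (ω : Ω) :
      (n : ℕ∞) < Tz ω ↔ ∀ k, 1 ≤ k ∧ (0 < M k ω ∨ M k ω < -z) → n < k := by
    rw [hTzdef]
    exact ENat.coe_lt_sInf_image_iff _ n
  have hexit {n : ℕ} {ω : Ω} (h : Tz ω = n) : 1 ≤ n ∧ (0 < M n ω ∨ M n ω < -z) := by
    rw [hTzdef] at h
    exact ENat.mem_of_sInf_image_eq_coe h
  have hpos (ω : Ω) : (0 : ℕ∞) < Tz ω := by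
    exact_mod_cast (hlt 0 ω).mpr fun k hk => hk.1
  have hMmeas (n : ℕ) : Measurable[𝓕 n] (M n) := (hM.stronglyMeasurable n).measurable
  have hMmeas' (n : ℕ) : Measurable (M n) := (hMmeas n).mono (𝓕.le n) le_rfl
  have hTmeas (n : ℕ) : MeasurableSet[𝓕 n] {ω | (n : ℕ∞) < Tz ω} := by
    have heq : {ω | (n : ℕ∞) < Tz ω} =
        ⋂ k ∈ Finset.Icc 1 n, M k ⁻¹' Icc (-z) 0 := by
      ext ω
      simp only [mem_ofPred_eq, hlt, mem_iInter, Finset.mem_Icc, mem_preimage, mem_Icc]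
      refine ⟨fun h k hk => ?_, fun h k hk => ?_⟩
      · by_contra hcon
        have := h k ⟨hk.1, by grind⟩
        omega
      · by_contra hcon
        have := h k ⟨hk.1, by omega⟩
        grind
    rw [heq]
    refine Finset.measurableSet_biInter _ fun k hk => ?_
    exact 𝓕.mono (Finset.mem_Icc.mp hk).2 _ (hMmeas k measurableSet_Icc)
  have hTmeas' (n : ℕ) : MeasurableSet {ω | (n : ℕ∞) < Tz ω} := 𝓕.le n _ (hTmeas n)
  have hsucc (n : ℕ) (ω : Ω) :
      (n : ℕ∞) < Tz ω ↔ Tz ω = ((n + 1 : ℕ) : ℕ∞) ∨ ((n + 1 : ℕ) : ℕ∞) < Tz ω := by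
    induction Tz ω using ENat.recTopCoe with
    | top => simp
    | coe m => norm_cast; omega
  have hTeq (n : ℕ) : MeasurableSet {ω | Tz ω = ((n + 1 : ℕ) : ℕ∞)} := by
    have heq : {ω | Tz ω = ((n + 1 : ℕ) : ℕ∞)} =
        {ω | (n : ℕ∞) < Tz ω} \ {ω | ((n + 1 : ℕ) : ℕ∞) < Tz ω} := by
      ext ω
      simp only [Set.mem_sdiff, mem_ofPred_eq, hsucc n ω]
      exact ⟨fun h => ⟨Or.inl h, h.not_gt⟩, fun h => h.1.resolve_right h.2⟩
    rw [heq]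
    exact (hTmeas' n).diff (hTmeas' (n + 1))
  let U (n : ℕ) : Set Ω := {ω | Tz ω = (n : ℕ∞) ∧ 0 < M n ω}
  let D (n : ℕ) : Set Ω := {ω | Tz ω = (n : ℕ∞) ∧ M n ω < -z}
  have hUmeas (n : ℕ) : MeasurableSet (U (n + 1)) :=
    (hTeq n).inter (measurableSet_lt measurable_const (hMmeas' _))
  have hDmeas (n : ℕ) : MeasurableSet (D (n + 1)) :=
    (hTeq n).inter (measurableSet_lt (hMmeas' _) measurable_const)
  have hUint (n : ℕ) : ∫ ω in U (n + 1), M (n + 1) ω ∂μ ≤ B * μ.real (U (n + 1)) := by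
    rcases (zero_le (a := μ (U (n + 1)))).eq_or_lt with h | h
    · rw [Measure.restrict_eq_zero.mpr h.symm, measureReal_def, ← h]
      simp
    · exact hover (n + 1) (by omega) h
  have hDint (n : ℕ) : ∫ ω in D (n + 1), M (n + 1) ω ∂μ ≤ -z * μ.real (D (n + 1)) := by
    calc ∫ ω in D (n + 1), M (n + 1) ω ∂μ ≤ ∫ _ in D (n + 1), -z ∂μ :=
          setIntegral_mono_on (hM.integrable _).integrableOn (integrable_const _).integrableOn
            (hDmeas n) fun ω hω => hω.2.le
      _ = -z * μ.real (D (n + 1)) := by simp [mul_comm]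
  have hsplit (n : ℕ) : ∫ ω in {ω | (n : ℕ∞) < Tz ω}, M n ω ∂μ =
      ∫ ω in U (n + 1), M (n + 1) ω ∂μ + ∫ ω in D (n + 1), M (n + 1) ω ∂μ +
        ∫ ω in {ω | ((n + 1 : ℕ) : ℕ∞) < Tz ω}, M (n + 1) ω ∂μ := by
    have heq : {ω | (n : ℕ∞) < Tz ω} =
        (U (n + 1) ∪ D (n + 1)) ∪ {ω | ((n + 1 : ℕ) : ℕ∞) < Tz ω} := by
      ext ω
      simp only [mem_union, mem_ofPred_eq, hsucc n ω, U, D, ← and_or_left]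
      exact or_congr_left ⟨fun h => ⟨h, (hexit h).2⟩, fun h => h.1⟩
    have hi : Integrable (M (n + 1)) μ := hM.integrable _
    rw [hM.setIntegral_eq n.le_succ (hTmeas n), heq,
      setIntegral_union _ (hTmeas' _) hi.integrableOn hi.integrableOn,
      setIntegral_union _ (hDmeas n) hi.integrableOn hi.integrableOn]
    · refine Set.disjoint_left.mpr fun ω hU hD => ?_
      linarith [hU.2, hD.2]
    · refine Set.disjoint_left.mpr fun ω hUD hlt => ?_
      rcases hUD with h | h <;> exact hlt.ne' h.1
  have hbound (n : ℕ) : 0 ≤ B * ∑ k ∈ Finset.range n, μ.real (U (k + 1)) -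
      z * ∑ k ∈ Finset.range n, μ.real (D (k + 1)) +
        ∫ ω in {ω | (n : ℕ∞) < Tz ω}, M n ω ∂μ := by
    induction n with
    | zero => simp [hpos, hmean]
    | succ n ih =>
      rw [hsplit n] at ih
      rw [Finset.sum_range_succ, Finset.sum_range_succ]
      linarith [hUint n, hDint n]
  have hrest (n : ℕ) (hn : 1 ≤ n) : ∫ ω in {ω | (n : ℕ∞) < Tz ω}, M n ω ∂μ ≤ 0 := by
    refine setIntegral_nonpos (hTmeas' n) fun ω hω => ?_
    by_contra! hcon
    exact lt_irrefl n ((hlt n ω).mp hω n ⟨hn, Or.inl hcon⟩)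
  have hUsum := hasSum_measureReal_eq_coe_succ (μ := μ) (fun ω => (hpos ω).ne')
    (A := fun n => {ω | 0 < M n ω}) hUmeas
  have hDsum := hasSum_measureReal_eq_coe_succ (μ := μ) (fun ω => (hpos ω).ne')
    (A := fun n => {ω | M n ω < -z}) hDmeas
  simp only [mem_ofPred_eq] at hUsum hDsum
  set p := μ.real {ω | Tz ω < ⊤ ∧ 0 < M (Tz ω).toNat ω} with hp
  set q := μ.real {ω | Tz ω < ⊤ ∧ M (Tz ω).toNat ω < -z} with hq
  have hlim : 0 ≤ B * p - z * q := by
    refine ge_of_tendsto ((hUsum.tendsto_sum_nat.const_mul B).sub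
      (hDsum.tendsto_sum_nat.const_mul z)) ?_
    filter_upwards [eventually_ge_atTop 1] with n hn
    have := hbound n
    have := hrest n hn
    simp only [U, D] at *
    linarith
  have htotal : 1 ≤ p + q := by
    have hone : μ.real {ω | Tz ω < ⊤} = 1 := by simp [measureReal_def, hfin]
    rw [← hone]
    refine (measureReal_mono fun ω hω => ?_).trans (measureReal_union_le _ _)
    have := (hexit (ENat.natCast_toNat (ne_of_lt hω)).symm).2
    exact this.imp (fun h => ⟨hω, h⟩) fun h => ⟨hω, h⟩
  have hmain : z ≤ p * (B + z) := by nlinarith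
  have hp0 : 0 ≤ p := measureReal_nonneg
  have hBz : 0 < B + z := by
    by_contra! hcon
    nlinarith
  exact ENNReal.ofReal_le_of_le_toReal ((div_le_iff₀ hBz).mpr hmain)
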